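/- Consider the acyclic causal model M with binary endogenous variables A, B, C, D, where the values of A, B, C are determined directly by the exogenous context and D satisfies the structural equation D = 1 iff (A = 1 and B = 1) or C = 1 (and D = 0 otherwise). Let u be the context in which A = 1, B = 0, and C = 1. Then A = 1 is an actual cause of D = 1 in (M,u) according to the original HP definition, in which condition AC2(b) is required to hold only for W⃗ itself (i.e., only for W⃗' = W⃗, while still for all subsets Z⃗' of Z⃗). In particular, the original and the revised HP definitions of actual cause are not equivalent. -/

import Mathlib

open scoped Classical

/-- A causal model: for each endogenous variable `X`, a structural equation `F X`
computing the value of `X` from the values of the exogenous variables and of the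
(other) endogenous variables. -/
structure CausalModel (U : Type) (RU : U → Type) (V : Type) (R : V → Type) where
  F : (X : V) → ((u : U) → RU u) → ((Y : V) → R Y) → R X

/-- A context: an assignment of values to the exogenous variables. -/
def Ctx (U : Type) (RU : U → Type) : Type := (u : U) → RU u

/-- A world: an assignment of values to the endogenous variables. -/
def World (V : Type) (R : V → Type) : Type := (X : V) → R X

variable {U : Type} {RU : U → Type} {V : Type} {R : V → Type}

/-- `v` is a solution of the structural equations of `M` in context `u`. -/
def Solves (M : CausalModel U RU V R) (u : Ctx U RU) (v : World V R) : Prop :=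
  ∀ X, v X = M.F X u v

/-- `M` is acyclic: there is a strict total order on the endogenous variables such
that `F X` does not depend on the value of `Y` unless `Y ≺ X`. -/
def CausalModel.Acyclic (M : CausalModel U RU V R) : Prop :=
  ∃ lt : V → V → Prop, IsStrictTotalOrder V lt ∧
    ∀ X Y : V, ¬ lt Y X →
      ∀ (u : Ctx U RU) (v : World V R) (y : R Y),
        M.F X u (Function.update v Y y) = M.F X u v

/-- A partial assignment of values to endogenous variables (an intervention). -/
def PAssign (V : Type) (R : V → Type) : Type := (X : V) → Option (R X)

/-- The partial assignment setting the variables in `A` to the values given by `w`. -/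
noncomputable def restrictTo (A : Set V) (w : World V R) : PAssign V R :=
  fun X => if X ∈ A then some (w X) else none

/-- Combination of partial assignments, with priority to the first. -/
def PAssign.union (g h : PAssign V R) : PAssign V R :=
  fun X => (g X).orElse (fun _ => h X)

/-- The partial assignment setting the single variable `X` to `x`. -/
noncomputable def PAssign.single (X : V) (x : R X) : PAssign V R :=
  fun Y => if h : X = Y then some (h ▸ x) else none

/-- The intervened model `M_{g}`: variables in the domain of `g` get the constant
equation given by `g`; the others keep their equation from `M`. -/
def intervene (M : CausalModel U RU V R) (g : PAssign V R) : CausalModel U RU V R where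
  F := fun X u v => (g X).elim (M.F X u v) id

/-- Causal formulas: primitive events `X = x`, Boolean combinations, and
intervention formulas `[Y⃗ ← y⃗]φ`. -/
inductive CForm (V : Type) (R : V → Type) : Type where
  | prim (X : V) (x : R X)
  | neg (φ : CForm V R)
  | conj (φ ψ : CForm V R)
  | intv (g : PAssign V R) (φ : CForm V R)

/-- A formula is an event if it is a Boolean combination of primitive events
(no interventions). -/
def CForm.IsEvent : CForm V R → Prop
  | .prim _ _ => True
  | .neg φ => φ.IsEvent
  | .conj φ ψ => φ.IsEvent ∧ ψ.IsEvent
  | .intv _ _ => False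

/-- The endogenous variables mentioned in a formula. -/
def CForm.vars : CForm V R → Set V
  | .prim X _ => {X}
  | .neg φ => φ.vars
  | .conj φ ψ => φ.vars ∪ ψ.vars
  | .intv g φ => {X | g X ≠ none} ∪ φ.vars

/-- Satisfaction of causal formulas: `(M,u) ⊨ X = x` iff `X` has value `x` in the
(unique, for acyclic models) solution; `(M,u) ⊨ [g]φ` iff `(M_g, u) ⊨ φ`. -/
def Sat : CausalModel U RU V R → Ctx U RU → CForm V R → Prop
  | M, u, .prim X x => ∃ v, Solves M u v ∧ v X = x
  | M, u, .neg φ => ¬ Sat M u φ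
  | M, u, .conj φ ψ => Sat M u φ ∧ Sat M u ψ
  | M, u, .intv g φ => Sat (intervene M g) u φ

/-- AC1 and AC2 of the (updated) HP definition, with witnesses `W, w, xs'`:
`X⃗ = x⃗` (given by the set `Xs` of variables and values `xs`) is a weak cause of
`φ` in `(M,u)`. -/
def WeakCause (M : CausalModel U RU V R) (u : Ctx U RU)
    (Xs : Finset V) (xs : World V R) (φ : CForm V R)
    (W : Set V) (w : World V R) (xs' : World V R) : Prop :=
  -- AC1
  (∀ X ∈ Xs, Sat M u (.prim X (xs X))) ∧ Sat M u φ ∧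
  -- AC2: X⃗ is included in Z⃗ = Wᶜ
  Disjoint (↑Xs : Set V) W ∧
  ∀ zs : World V R, (∀ Z ∈ Wᶜ, Sat M u (.prim Z (zs Z))) →
    -- AC2(a)
    (Sat M u (.intv ((restrictTo (↑Xs) xs').union (restrictTo W w)) (.neg φ)) ∧
    -- AC2(b)
    ∀ W' ⊆ W, ∀ Z' ⊆ Wᶜ,
      Sat M u (.intv (((restrictTo (↑Xs) xs).union (restrictTo W' w)).union
        (restrictTo Z' zs)) φ))

/-- The (updated) HP definition of actual cause: AC1, AC2 (for some witness), and
the minimality condition AC3. -/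
def ActualCause (M : CausalModel U RU V R) (u : Ctx U RU)
    (Xs : Finset V) (xs : World V R) (φ : CForm V R) : Prop :=
  (∃ W w xs', WeakCause M u Xs xs φ W w xs') ∧
  ∀ Ys : Finset V, Ys ⊂ Xs → ¬ ∃ W w xs', WeakCause M u Ys xs φ W w xs'

/-- AC1 and AC2 of the *original* HP definition, with witnesses `W, w, xs'`:
AC2(b) is required to hold only for `W⃗` itself (i.e., only for `W⃗' = W⃗`, while
still for all subsets `Z⃗'` of `Z⃗`). -/
def OrigWeakCause {U : Type} {RU : U → Type} {V : Type} {R : V → Type}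
    (M : CausalModel U RU V R) (u : Ctx U RU)
    (Xs : Finset V) (xs : World V R) (φ : CForm V R)
    (W : Set V) (w : World V R) (xs' : World V R) : Prop :=
  -- AC1
  (∀ X ∈ Xs, Sat M u (.prim X (xs X))) ∧ Sat M u φ ∧
  -- AC2: X⃗ is included in Z⃗ = Wᶜ
  Disjoint (↑Xs : Set V) W ∧
  ∀ zs : World V R, (∀ Z ∈ Wᶜ, Sat M u (.prim Z (zs Z))) →
    -- AC2(a)
    (Sat M u (.intv ((restrictTo (↑Xs) xs').union (restrictTo W w)) (.neg φ)) ∧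
    -- AC2(b), only for W itself
    ∀ Z' ⊆ Wᶜ,
      Sat M u (.intv (((restrictTo (↑Xs) xs).union (restrictTo W w)).union
        (restrictTo Z' zs)) φ))

/-- The original HP definition of actual cause. -/
def OrigActualCause {U : Type} {RU : U → Type} {V : Type} {R : V → Type}
    (M : CausalModel U RU V R) (u : Ctx U RU)
    (Xs : Finset V) (xs : World V R) (φ : CForm V R) : Prop :=
  (∃ W w xs', OrigWeakCause M u Xs xs φ W w xs') ∧
  ∀ Ys : Finset V, Ys ⊂ Xs → ¬ ∃ W w xs', OrigWeakCause M u Ys xs φ W w xs'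

/-- The endogenous variables of the loading/shooting example. -/
inductive GunVar : Type where
  | A | B | C | D
deriving DecidableEq

/-- The causal model: the exogenous context (a triple of Booleans) directly
determines `A`, `B`, `C`, and `D = 1` iff (`A = 1` and `B = 1`) or `C = 1`. -/
def gunModel : CausalModel Unit (fun _ => Bool × Bool × Bool) GunVar (fun _ => Bool) where
  F := fun X u v =>
    match X with
    | .A => (u ()).1
    | .B => (u ()).2.1
    | .C => (u ()).2.2
    | .D => (v .A && v .B) || v .C

/-- The context in which `A = 1`, `B = 0`, and `C = 1`. -/
def gunCtx : Ctx Unit (fun _ => Bool × Bool × Bool) := fun _ => (true, false, true)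

/-- In the intervened gun model, the solution is obtained by evaluating the equations in order. -/
theorem sat_intervene_gunModel_D (g : PAssign GunVar (fun _ => Bool)) (b : Bool) :
    Sat (intervene gunModel g) gunCtx (.prim GunVar.D b) ↔
      (g .D).getD (((g .A).getD true && (g .B).getD false) || (g .C).getD true) = b := by
  constructor
  · rintro ⟨v, hv, rfl⟩
    have hA := hv .A
    have hB := hv .B
    have hC := hv .C
    have hD := hv .D
    simp only [intervene, gunModel, gunCtx] at hA hB hC hD
    rw [hD, hA, hB, hC]
    cases g .A <;> cases g .B <;> cases g .C <;> cases g .D <;> rfl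
  · rintro rfl
    refine ⟨fun X => match X with
      | .A => (g .A).getD true
      | .B => (g .B).getD false
      | .C => (g .C).getD true
      | .D => (g .D).getD (((g .A).getD true && (g .B).getD false) || (g .C).getD true), ?_, rfl⟩
    intro X
    cases X <;> simp only [intervene, gunModel, gunCtx]
    · cases g .A <;> rfl
    · cases g .B <;> rfl
    · cases g .C <;> rfl
    · cases g .D <;> rfl

/-- The actual world of the gun example. -/
def gunWorld : World GunVar (fun _ => Bool)
  | .A => true
  | .B => false
  | .C => true
  | .D => true

theorem solves_gunModel_iff (v : World GunVar (fun _ => Bool)) :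
    Solves gunModel gunCtx v ↔ v = gunWorld := by
  constructor
  · intro hv
    have hA : v .A = true := hv .A
    have hB : v .B = false := hv .B
    have hC : v .C = true := hv .C
    have hD : v .D = ((v .A && v .B) || v .C) := hv .D
    rw [hA, hB, hC] at hD
    funext X
    cases X
    exacts [hA, hB, hC, hD]
  · rintro rfl X
    cases X <;> rfl

theorem sat_gunModel_prim (X : GunVar) (b : Bool) :
    Sat gunModel gunCtx (.prim X b) ↔ gunWorld X = b := by
  simp [Sat, solves_gunModel_iff]

/-- The empty conjunction is never a weak cause in the gun example. -/
theorem not_origWeakCause_gunModel_empty (xs : World GunVar (fun _ => Bool))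
    (φ : CForm GunVar (fun _ => Bool)) (W : Set GunVar) (w xs' : World GunVar (fun _ => Bool)) :
    ¬ OrigWeakCause gunModel gunCtx ∅ xs φ W w xs' := by
  rintro ⟨-, -, -, h⟩
  obtain ⟨ha, hb⟩ := h gunWorld fun Z _ => (sat_gunModel_prim Z _).2 rfl
  have hb := hb ∅ (Set.empty_subset _)
  have e : ((restrictTo (↑(∅ : Finset GunVar)) xs).union (restrictTo W w)).union
      (restrictTo ∅ gunWorld) =
      (restrictTo (↑(∅ : Finset GunVar)) xs').union (restrictTo W w) := by
    funext X
    simp [PAssign.union, restrictTo]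
  rw [e] at hb
  exact ha hb

theorem origWeakCause_gunModel :
    OrigWeakCause gunModel gunCtx {GunVar.A} (fun _ => true) (.prim GunVar.D true)
      {GunVar.B, GunVar.C} (fun X => decide (X = GunVar.B)) (fun _ => false) := by
  refine ⟨?_, ?_, ?_, ?_⟩
  · intro X hX
    rw [Finset.mem_singleton] at hX
    subst hX
    exact (sat_gunModel_prim _ _).2 rfl
  · exact (sat_gunModel_prim _ _).2 rfl
  · simp
  · intro zs hzs
    have hD : true = zs .D := (sat_gunModel_prim _ _).1 (hzs .D (by simp))
    refine ⟨?_, fun Z' hZ' => ?_⟩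
    · simp only [Sat]
      rw [← Sat, sat_intervene_gunModel_D]
      simp [PAssign.union, restrictTo]
    · rw [Sat, sat_intervene_gunModel_D]
      by_cases h : GunVar.D ∈ Z' <;> simp [PAssign.union, restrictTo, h, ← hD]

theorem not_weakCause_gunModel (W : Set GunVar) (w xs' : World GunVar (fun _ => Bool)) :
    ¬ WeakCause gunModel gunCtx {GunVar.A} (fun _ => true) (.prim GunVar.D true) W w xs' := by
  rintro ⟨-, -, -, h⟩
  obtain ⟨ha, hb⟩ := h gunWorld fun Z _ => (sat_gunModel_prim Z _).2 rfl
  have hW := hb W subset_rfl ∅ (Set.empty_subset _)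
  have hC := hb (W ∩ {GunVar.C}) Set.inter_subset_left ∅ (Set.empty_subset _)
  change ¬ Sat (intervene gunModel _) gunCtx (.prim GunVar.D true) at ha
  rw [Sat, sat_intervene_gunModel_D] at hW hC
  rw [sat_intervene_gunModel_D] at ha
  by_cases hDW : GunVar.D ∈ W <;> by_cases hCW : GunVar.C ∈ W <;>
    simp_all [PAssign.union, restrictTo]

/-- in this model and context, `A = 1` is an actual cause of `D = 1`
according to the *original* HP definition (but not according to the revised one);
in particular the original and revised HP definitions are not equivalent. -/
theorem gun_orig_cause :
    OrigActualCause gunModel gunCtx {GunVar.A} (fun _ => true) (.prim GunVar.D true) ∧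
    ¬ ActualCause gunModel gunCtx {GunVar.A} (fun _ => true) (.prim GunVar.D true) := by
  refine ⟨⟨⟨_, _, _, origWeakCause_gunModel⟩, ?_⟩, ?_⟩
  · rintro Ys hYs ⟨W, w, xs', h⟩
    rw [Finset.ssubset_singleton_iff] at hYs
    subst hYs
    exact not_origWeakCause_gunModel_empty _ _ W w xs' h
  · rintro ⟨⟨W, w, xs', h⟩, -⟩
    exact not_weakCause_gunModel W w xs' h
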